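/- Let φ₁, φ₂ : ∂𝔻 → ℝ be bounded lower semicontinuous functions and let ψ₁, ψ₂ : 𝔻 → ℝ be smooth functions with a ≤ ψᵢ(z) ≤ b for all z ∈ 𝔻 and some 0 < a ≤ b < +∞. Suppose φ₁(z) ≤ φ₂(z) for all z ∈ ∂𝔻 and ψ₁(z) ≤ ψ₂(z) for all z ∈ 𝔻. If u₁, u₂ : 𝔻 → ℝ are smooth convex functions with det D²uᵢ(z) = (1/ψᵢ(z))·(1−|z|²)⁻² on 𝔻 and liminf_{w→z, w∈𝔻} uᵢ(w) = φᵢ(z) for every z ∈ ∂𝔻 (i = 1, 2), then u₁(z) ≤ u₂(z) for all z ∈ 𝔻. -/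

import Mathlib

open Metric Filter
open scoped RealInnerProductSpace Topology

noncomputable section

/-- The plane `ℝ²`, as a Euclidean space. -/
abbrev E2 : Type := EuclideanSpace ℝ (Fin 2)

/-- The Hessian of `f : ℝ² → ℝ` at `p`, evaluated as a bilinear form on `(v, w)`. -/
def hess (f : E2 → ℝ) (p v w : E2) : ℝ := fderiv ℝ (fderiv ℝ f) p v w

/-- The determinant of the Hessian of `f : ℝ² → ℝ` at `p`. -/
def detHess (f : E2 → ℝ) (p : E2) : ℝ :=
  hess f p (EuclideanSpace.single 0 1) (EuclideanSpace.single 0 1) *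
    hess f p (EuclideanSpace.single 1 1) (EuclideanSpace.single 1 1) -
  hess f p (EuclideanSpace.single 0 1) (EuclideanSpace.single 1 1) *
    hess f p (EuclideanSpace.single 1 1) (EuclideanSpace.single 0 1)


/-- `f` is twice differentiable at `0` in the line sense, with second derivative `h`. -/
def Sec (f : ℝ → ℝ) (h : ℝ) : Prop :=
  ∃ f1 : ℝ → ℝ, (∀ᶠ s in 𝓝 (0 : ℝ), HasDerivAt f (f1 s) s) ∧ HasDerivAt f1 h 0

lemma Sec.add {f g : ℝ → ℝ} {h k : ℝ} (hf : Sec f h) (hg : Sec g k) :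
    Sec (fun s => f s + g s) (h + k) := by
  obtain ⟨f1, hf1, hf2⟩ := hf
  obtain ⟨g1, hg1, hg2⟩ := hg
  refine ⟨fun s => f1 s + g1 s, ?_, hf2.fun_add hg2⟩
  filter_upwards [hf1, hg1] with s a b using a.fun_add b

lemma Sec.const_mul {f : ℝ → ℝ} {h : ℝ} (c : ℝ) (hf : Sec f h) :
    Sec (fun s => c * f s) (c * h) := by
  obtain ⟨f1, hf1, hf2⟩ := hf
  refine ⟨fun s => c * f1 s, ?_, hf2.const_mul c⟩
  filter_upwards [hf1] with s a using a.const_mul c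

lemma Sec.sub {f g : ℝ → ℝ} {h k : ℝ} (hf : Sec f h) (hg : Sec g k) :
    Sec (fun s => f s - g s) (h - k) := by
  have := hf.add (hg.const_mul (-1))
  simpa [sub_eq_add_neg] using this

lemma sec_poly (a b c : ℝ) : Sec (fun s => a + b * s + c * s ^ 2) (2 * c) := by
  refine ⟨fun s => b + c * (2 * s), ?_, ?_⟩
  · refine Eventually.of_forall fun s => ?_
    have h1 := ((hasDerivAt_id s).const_mul b).const_add a
    have h2 := ((hasDerivAt_id s).pow 2).const_mul c
    have := h1.add h2
    convert this using 1 <;> try (ext; simp)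
    simp
  · have := (((hasDerivAt_id (0:ℝ)).const_mul 2).const_mul c).const_add b
    convert this using 1 <;> try (ext; simp)
    simp [mul_comm]

lemma Sec.nonneg {f : ℝ → ℝ} {h : ℝ} (hf : Sec f h) (hm : IsLocalMin f 0) : 0 ≤ h := by
  by_contra hneg
  push Not at hneg
  have hk : Sec (fun s => -1 * f s + (0 + 0 * s + (h / 4) * s ^ 2)) (-1 * h + 2 * (h / 4)) :=
    (hf.const_mul (-1)).add (sec_poly 0 0 (h / 4))
  obtain ⟨k1, hk1, hk2⟩ := hk
  set k : ℝ → ℝ := fun s => -1 * f s + (0 + 0 * s + (h / 4) * s ^ 2) with hkdef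
  have hd : deriv k =ᶠ[𝓝 0] k1 := hk1.mono fun s hs => hs.deriv
  have hk0 : deriv k 0 = 0 := by
    obtain ⟨f1, hf1, hf2⟩ := hf
    have e1 : HasDerivAt f (f1 0) 0 := hf1.self_of_nhds
    have e2 : f1 0 = 0 := hm.hasDerivAt_eq_zero e1
    have e3 := (e1.const_mul (-1)).add
      (((((hasDerivAt_id (0:ℝ)).const_mul 0).const_add 0)).add
        (((hasDerivAt_id (0:ℝ)).pow 2).const_mul (h/4)))
    have e4 : HasDerivAt k 0 0 := by
      refine e3.congr_deriv ?_
      simp [e2]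
    exact e4.deriv
  have hmin : IsLocalMin k 0 := by
    apply isLocalMin_of_deriv_deriv_pos
    · rw [hd.deriv_eq, hk2.deriv]; linarith
    · exact hk0
    · exact (hk1.self_of_nhds).continuousAt
  have hev : ∀ᶠ s in 𝓝[≠] (0:ℝ), False := by
    have a1 := hm.filter_mono (nhdsWithin_le_nhds (s := {0}ᶜ))
    have a2 := hmin.filter_mono (nhdsWithin_le_nhds (s := {0}ᶜ))
    filter_upwards [a1, a2, self_mem_nhdsWithin] with s b1 b2 b3
    have : 0 < s ^ 2 := by have : s ≠ 0 := b3; positivity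
    simp only [hkdef] at b2
    nlinarith
  exact (NeBot.ne (f := 𝓝[≠] (0:ℝ)) inferInstance) (by simpa using hev)

lemma sec_sqrt (A B D : ℝ) (hA : 0 < A) :
    Sec (fun s => √(A - 2 * B * s - D * s ^ 2)) (-(D / √A + B ^ 2 / (√A) ^ 3)) := by
  have hp : ∀ s : ℝ, HasDerivAt (fun s => A - 2 * B * s - D * s ^ 2) (-2 * B - 2 * D * s) s := by
    intro s
    have h1 := (((hasDerivAt_id s).const_mul (2 * B)).const_sub A).sub
      (((hasDerivAt_id s).pow 2).const_mul D)
    refine h1.congr_deriv ?_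
    simp; ring
  have hpos : ∀ᶠ s in 𝓝 (0:ℝ), 0 < A - 2 * B * s - D * s ^ 2 := by
    have hc : ContinuousAt (fun s => A - 2 * B * s - D * s ^ 2) 0 := (hp 0).continuousAt
    exact hc.eventually (lt_mem_nhds (by simpa using hA))
  refine ⟨fun s => (-2 * B - 2 * D * s) / (2 * √(A - 2 * B * s - D * s ^ 2)), ?_, ?_⟩
  · filter_upwards [hpos] with s hs using (hp s).sqrt hs.ne'
  · have h1 : HasDerivAt (fun s : ℝ => -2 * B - 2 * D * s) (-(2 * D)) 0 := by
      have := ((hasDerivAt_id (0:ℝ)).const_mul (2 * D)).const_sub (-2 * B)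
      refine this.congr_deriv ?_
      simp
    have h2 := ((hp 0).sqrt (by simpa using hA.ne')).const_mul 2
    have hq : 0 < √A := Real.sqrt_pos.2 hA
    have h3 := h1.div h2 (by simp; exact hq.ne')
    refine h3.congr_deriv ?_
    simp
    field_simp
    ring

lemma psd_coef {a b c : ℝ} (h : ∀ x y : ℝ, 0 ≤ a * x ^ 2 + 2 * b * (x * y) + c * y ^ 2) :
    0 ≤ a ∧ 0 ≤ c ∧ b ^ 2 ≤ a * c := by
  refine ⟨by simpa using h 1 0, by simpa using h 0 1, ?_⟩
  have := discrim_le_zero (a := a) (b := 2 * b) (c := c) (fun x => by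
    have := h x 1
    nlinarith)
  rw [discrim] at this
  nlinarith

lemma mixed_nonneg {a b c p q r : ℝ} (ha : 0 ≤ a) (hc : 0 ≤ c) (hb : b ^ 2 ≤ a * c)
    (hp : 0 ≤ p) (hr : 0 ≤ r) (hq : q ^ 2 ≤ p * r) : 0 ≤ a * r + c * p - 2 * b * q := by
  have h1 : (2 * b * q) ^ 2 ≤ (a * r + c * p) ^ 2 := by
    have : b ^ 2 * q ^ 2 ≤ (a * c) * (p * r) := mul_le_mul hb hq (sq_nonneg _) (by positivity)
    nlinarith [sq_nonneg (a * r - c * p)]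
  have h2 := abs_le_of_sq_le_sq h1 (by positivity)
  linarith [(abs_le.1 h2).2]

lemma det_add {a b c p q r : ℝ} (ha : 0 ≤ a) (hc : 0 ≤ c) (hb : b ^ 2 ≤ a * c)
    (hp : 0 ≤ p) (hr : 0 ≤ r) (hq : q ^ 2 ≤ p * r) :
    (a * c - b ^ 2) + (p * r - q ^ 2) ≤ (a + p) * (c + r) - (b + q) ^ 2 := by
  nlinarith [mixed_nonneg ha hc hb hp hr hq]

/-- monotonicity of the determinant -/
lemma det_mono {a b c p q r : ℝ} (hX : 0 ≤ a) (hX' : 0 ≤ c) (hX'' : b ^ 2 ≤ a * c)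
    (h : ∀ x y : ℝ, a * x ^ 2 + 2 * b * (x * y) + c * y ^ 2
      ≤ p * x ^ 2 + 2 * q * (x * y) + r * y ^ 2) :
    a * c - b ^ 2 ≤ p * r - q ^ 2 := by
  obtain ⟨h1, h2, h3⟩ := psd_coef (a := p - a) (b := q - b) (c := r - c) (fun x y => by
    have := h x y
    nlinarith)
  have := det_add hX hX' hX'' h1 h2 h3
  simp only [add_sub_cancel] at this
  linarith

lemma line_hasDeriv (z v : E2) (s : ℝ) : HasDerivAt (fun s : ℝ => z + s • v) v s := by
  have := ((hasDerivAt_id s).smul_const v).const_add z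
  simpa using this

lemma cda {u : E2 → ℝ} (hu : ContDiffOn ℝ (⊤ : ℕ∞) u (ball (0 : E2) 1)) {z : E2}
    (hz : z ∈ ball (0 : E2) 1) : ContDiffAt ℝ 2 u z :=
  (hu.contDiffAt (isOpen_ball.mem_nhds hz)).of_le (WithTop.coe_le_coe.2 (le_top : (2 : ℕ∞) ≤ ⊤))

lemma line_mem (z v : E2) (hz : z ∈ ball (0 : E2) 1) :
    ∀ᶠ s in 𝓝 (0:ℝ), z + s • v ∈ ball (0 : E2) 1 := by
  have hc : ContinuousAt (fun s : ℝ => z + s • v) 0 := (line_hasDeriv z v 0).continuousAt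
  exact hc.eventually (isOpen_ball.mem_nhds (by simpa using hz))

lemma sec_line {u : E2 → ℝ} (hu : ContDiffOn ℝ (⊤ : ℕ∞) u (ball (0 : E2) 1)) {z : E2}
    (hz : z ∈ ball (0 : E2) 1) (v : E2) : Sec (fun s => u (z + s • v)) (hess u z v v) := by
  refine ⟨fun s => fderiv ℝ u (z + s • v) v, ?_, ?_⟩
  · filter_upwards [line_mem z v hz] with s hs
    exact ((cda hu hs).differentiableAt (by norm_num)).hasFDerivAt.comp_hasDerivAt s
      (line_hasDeriv z v s)
  · have h1 : DifferentiableAt ℝ (fderiv ℝ u) z :=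
      ((cda hu hz).fderiv_right (m := 1) (by norm_num)).differentiableAt (by norm_num)
    have h2 : HasFDerivAt (fderiv ℝ u) (fderiv ℝ (fderiv ℝ u) z) (z + (0:ℝ) • v) := by
      simpa using h1.hasFDerivAt
    have h3 := h2.comp_hasDerivAt 0 (line_hasDeriv z v 0)
    have h4 := h3.clm_apply (hasDerivAt_const 0 v)
    simpa [hess, Function.comp_def] using h4

lemma grad_ineq {u : E2 → ℝ} (hu : ContDiffOn ℝ (⊤ : ℕ∞) u (ball (0 : E2) 1))
    (hc : ConvexOn ℝ (ball (0 : E2) 1) u) {z w : E2}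
    (hz : z ∈ ball (0 : E2) 1) (hw : w ∈ ball (0 : E2) 1) :
    u z + fderiv ℝ u z (w - z) ≤ u w := by
  have hco : ConvexOn ℝ ((AffineMap.lineMap z w : ℝ →ᵃ[ℝ] E2) ⁻¹' ball (0 : E2) 1)
      (u ∘ (AffineMap.lineMap z w : ℝ →ᵃ[ℝ] E2)) := hc.comp_affineMap _
  have hd : HasDerivAt (u ∘ (AffineMap.lineMap z w : ℝ →ᵃ[ℝ] E2)) (fderiv ℝ u z (w - z)) 0 := by
    have h1 : HasFDerivAt u (fderiv ℝ u z) ((AffineMap.lineMap z w : ℝ →ᵃ[ℝ] E2) 0) := by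
      simpa using ((cda hu hz).differentiableAt (by norm_num)).hasFDerivAt
    exact h1.comp_hasDerivAt 0 AffineMap.hasDerivAt_lineMap
  have := hco.le_slope_of_hasDerivAt (x := 0) (y := 1) (by simpa using hz) (by simpa using hw)
    one_pos hd
  simp [slope_def_field] at this
  rw [map_sub]
  linarith

lemma hess_nonneg {u : E2 → ℝ} (hu : ContDiffOn ℝ (⊤ : ℕ∞) u (ball (0 : E2) 1))
    (hc : ConvexOn ℝ (ball (0 : E2) 1) u) {z : E2}
    (hz : z ∈ ball (0 : E2) 1) (v : E2) : 0 ≤ hess u z v v := by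
  have h1 := (sec_line hu hz v).sub (sec_poly (u z) (fderiv ℝ u z v) 0)
  have h2 := h1.nonneg (by
    filter_upwards [line_mem z v hz] with s hs
    have := grad_ineq hu hc hz hs
    simp at this ⊢
    linarith)
  simpa using h2

lemma bdd_below {u : E2 → ℝ} (hu : ContDiffOn ℝ (⊤ : ℕ∞) u (ball (0 : E2) 1))
    (hc : ConvexOn ℝ (ball (0 : E2) 1) u) : ∃ L : ℝ, ∀ w ∈ ball (0 : E2) 1, L ≤ u w := by
  have h0 : (0 : E2) ∈ ball (0 : E2) 1 := by simp
  refine ⟨u 0 - ‖fderiv ℝ u 0‖, fun w hw => ?_⟩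
  have h1 := grad_ineq hu hc h0 hw
  have h2 := (fderiv ℝ u 0).le_opNorm w
  have h3 : ‖w‖ < 1 := by simpa using hw
  have h4 : ‖fderiv ℝ u 0‖ * ‖w‖ ≤ ‖fderiv ℝ u 0‖ :=
    mul_le_of_le_one_right (norm_nonneg _) h3.le
  have h5 := neg_abs_le (fderiv ℝ u 0 w)
  rw [Real.norm_eq_abs] at h2
  simp at h1
  linarith

lemma hess_coord {u : E2 → ℝ} (hu : ContDiffOn ℝ (⊤ : ℕ∞) u (ball (0 : E2) 1)) {z : E2}
    (hz : z ∈ ball (0 : E2) 1) : ∃ a b c : ℝ, detHess u z = a * c - b ^ 2 ∧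
      ∀ x y : ℝ, hess u z !₂[x, y] !₂[x, y] = a * x ^ 2 + 2 * b * (x * y) + c * y ^ 2 := by
  have hs : hess u z (EuclideanSpace.single 1 1) (EuclideanSpace.single 0 1)
      = hess u z (EuclideanSpace.single 0 1) (EuclideanSpace.single 1 1) :=
    ((cda hu hz).isSymmSndFDerivAt (by simp)) _ _
  refine ⟨hess u z (EuclideanSpace.single 0 1) (EuclideanSpace.single 0 1),
    hess u z (EuclideanSpace.single 0 1) (EuclideanSpace.single 1 1),
    hess u z (EuclideanSpace.single 1 1) (EuclideanSpace.single 1 1), ?_, ?_⟩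
  · rw [detHess, hs]; ring
  · intro x y
    have hv : (!₂[x, y] : E2) = x • EuclideanSpace.single 0 1 + y • EuclideanSpace.single 1 1 := by
      ext i; fin_cases i <;> simp
    rw [hv]
    unfold hess at hs ⊢
    simp only [map_add, map_smul, add_apply, smul_apply, smul_eq_mul]
    rw [hs]; ring

lemma exists_min {F : E2 → ℝ} (hF : ContinuousOn F (ball (0 : E2) 1)) (m : ℝ)
    (hb : ∀ z ∈ sphere (0 : E2) 1, ∀ᶠ w in 𝓝[ball (0 : E2) 1] z, m < F w)
    {z' : E2} (hz' : z' ∈ ball (0 : E2) 1) (hm : F z' ≤ m) :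
    ∃ z0 ∈ ball (0 : E2) 1, F z0 ≤ m ∧ ∀ w ∈ ball (0 : E2) 1, F z0 ≤ F w := by
  set S : Set E2 := {z | z ∈ ball (0 : E2) 1 ∧ F z ≤ m} with hS
  have hSsub : S ⊆ closedBall (0 : E2) 1 := fun z hz => ball_subset_closedBall hz.1
  have hcl : IsClosed S := by
    refine isClosed_of_closure_subset fun z hz => ?_
    have hzc : z ∈ closedBall (0 : E2) 1 := closure_minimal hSsub isClosed_closedBall hz
    have hne : (𝓝[S] z).NeBot := mem_closure_iff_nhdsWithin_neBot.1 hz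
    have hle : 𝓝[S] z ≤ 𝓝[ball (0 : E2) 1] z := nhdsWithin_mono _ fun w hw => hw.1
    rcases (mem_closedBall.1 hzc).lt_or_eq with h | h
    · refine ⟨mem_ball.2 h, ?_⟩
      have ht : Tendsto F (𝓝[S] z) (𝓝 (F z)) := (hF z (mem_ball.2 h)).mono_left hle
      exact le_of_tendsto ht (eventually_mem_nhdsWithin.mono fun w hw => hw.2)
    · exfalso
      have h1 := (hb z (mem_sphere.2 h)).filter_mono hle
      obtain ⟨w, hw1, hw2⟩ := (h1.and eventually_mem_nhdsWithin).exists
      exact absurd hw2.2 (not_le.2 hw1)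
  have hcomp : IsCompact S := (isCompact_closedBall (0 : E2) 1).of_isClosed_subset hcl hSsub
  obtain ⟨z0, hz0, hmin⟩ := hcomp.exists_isMinOn ⟨z', hz', hm⟩ (hF.mono fun w hw => hw.1)
  refine ⟨z0, hz0.1, hz0.2, fun w hw => ?_⟩
  by_cases h : F w ≤ m
  · exact hmin ⟨hw, h⟩
  · exact hz0.2.trans (not_le.1 h).le

lemma norm_line (z v : E2) (s : ℝ) :
    ‖z + s • v‖ ^ 2 = ‖z‖ ^ 2 + 2 * ⟪z, v⟫ * s + ‖v‖ ^ 2 * s ^ 2 := by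
  rw [norm_add_sq_real, inner_smul_right, norm_smul, mul_pow, Real.norm_eq_abs, sq_abs]
  ring

lemma sub_pos_of_ball {z : E2} (hz : z ∈ ball (0 : E2) 1) : 0 < 1 - ‖z‖ ^ 2 := by
  have h3 : ‖z‖ < 1 := by simpa using hz
  nlinarith [norm_nonneg z]

lemma min_hess {u f : E2 → ℝ} (hu : ContDiffOn ℝ (⊤ : ℕ∞) u (ball (0 : E2) 1)) {z : E2}
    (hz : z ∈ ball (0 : E2) 1) (Hf : E2 → ℝ) (hf : ∀ v, Sec (fun s => f (z + s • v)) (Hf v))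
    (c ε : ℝ)
    (hmin : ∀ w ∈ ball (0 : E2) 1, u z - f z + c * √(1 - ‖z‖ ^ 2) - ε * ‖z‖ ^ 2
      ≤ u w - f w + c * √(1 - ‖w‖ ^ 2) - ε * ‖w‖ ^ 2) (v : E2) :
    Hf v + c * (‖v‖ ^ 2 / √(1 - ‖z‖ ^ 2) + ⟪z, v⟫ ^ 2 / √(1 - ‖z‖ ^ 2) ^ 3) + 2 * ε * ‖v‖ ^ 2
      ≤ hess u z v v := by
  have h1 := ((sec_line hu hz v).sub (hf v)).add
    ((sec_sqrt (1 - ‖z‖ ^ 2) ⟪z, v⟫ (‖v‖ ^ 2) (sub_pos_of_ball hz)).const_mul c)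
  have h2 := h1.sub ((sec_poly (‖z‖ ^ 2) (2 * ⟪z, v⟫) (‖v‖ ^ 2)).const_mul ε)
  have h3 := h2.nonneg (by
    filter_upwards [line_mem z v hz] with s hs
    have h4 := hmin _ hs
    have e1 : 1 - ‖z + s • v‖ ^ 2 = 1 - ‖z‖ ^ 2 - 2 * ⟪z, v⟫ * s - ‖v‖ ^ 2 * s ^ 2 := by
      rw [norm_line]; ring
    rw [e1, norm_line] at h4
    simpa using h4)
  linarith

lemma det_barrier {u f : E2 → ℝ} (hu : ContDiffOn ℝ (⊤ : ℕ∞) u (ball (0 : E2) 1)) {z : E2}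
    (hz : z ∈ ball (0 : E2) 1) (Hf : E2 → ℝ) (hf : ∀ v, Sec (fun s => f (z + s • v)) (Hf v))
    (hf0 : ∀ v, 0 ≤ Hf v) (c ε : ℝ) (hc : 0 ≤ c) (hε : 0 ≤ ε)
    (hmin : ∀ w ∈ ball (0 : E2) 1, u z - f z + c * √(1 - ‖z‖ ^ 2) - ε * ‖z‖ ^ 2
      ≤ u w - f w + c * √(1 - ‖w‖ ^ 2) - ε * ‖w‖ ^ 2) :
    c ^ 2 * ((1 - ‖z‖ ^ 2) ^ 2)⁻¹ ≤ detHess u z := by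
  obtain ⟨p, q, r, hdet, hform⟩ := hess_coord hu hz
  have hpos := sub_pos_of_ball hz
  have hQ : 0 < √(1 - ‖z‖ ^ 2) := Real.sqrt_pos.2 hpos
  have hQ2 : √(1 - ‖z‖ ^ 2) ^ 2 = 1 - ‖z‖ ^ 2 := Real.sq_sqrt hpos.le
  have hn : ‖z‖ ^ 2 = z 0 ^ 2 + z 1 ^ 2 := by
    rw [EuclideanSpace.norm_sq_eq]; simp [Fin.sum_univ_two]
  have key := fun x y : ℝ => min_hess hu hz Hf hf c ε hmin !₂[x, y]
  set Q := √(1 - ‖z‖ ^ 2) with hQdef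
  have hdetW : (c * (1 / Q + z 0 ^ 2 / Q ^ 3)) * (c * (1 / Q + z 1 ^ 2 / Q ^ 3))
      - (c * (z 0 * z 1 / Q ^ 3)) ^ 2 = c ^ 2 * ((1 - ‖z‖ ^ 2) ^ 2)⁻¹ := by
    rw [← hQ2]
    have h1 : z 0 ^ 2 + z 1 ^ 2 = 1 - Q ^ 2 := by rw [hQ2, hn]; ring
    have h2 : z 0 ^ 2 = 1 - Q ^ 2 - z 1 ^ 2 := by linarith
    field_simp
    ring_nf
    rw [h2]
    ring
  rw [hdet, ← hdetW]
  apply det_mono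
  · positivity
  · positivity
  · have : 0 ≤ c ^ 2 * ((1 - ‖z‖ ^ 2) ^ 2)⁻¹ := by positivity
    linarith
  · intro x y
    have h1 := key x y
    rw [hform] at h1
    have h2 := hf0 !₂[x, y]
    have e1 : ‖(!₂[x, y] : E2)‖ ^ 2 = x ^ 2 + y ^ 2 := by
      rw [EuclideanSpace.norm_sq_eq]; simp [Fin.sum_univ_two]
    have e2 : ⟪z, (!₂[x, y] : E2)⟫ = z 0 * x + z 1 * y := by
      rw [PiLp.inner_apply]; simp [Fin.sum_univ_two]; ring
    rw [e1, e2] at h1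
    have h3 : 0 ≤ 2 * ε * (x ^ 2 + y ^ 2) := by positivity
    have e3 : c * (1 / Q + z 0 ^ 2 / Q ^ 3) * x ^ 2 + 2 * (c * (z 0 * z 1 / Q ^ 3)) * (x * y)
        + c * (1 / Q + z 1 ^ 2 / Q ^ 3) * y ^ 2
        = c * ((x ^ 2 + y ^ 2) / Q + (z 0 * x + z 1 * y) ^ 2 / Q ^ 3) := by
      field_simp; ring
    linarith

lemma smul_mem {z : E2} (hz : z ∈ ball (0 : E2) 1) {r : ℝ} (hr : 0 ≤ r) (hr1 : r ≤ 1) :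
    r • z ∈ ball (0 : E2) 1 := by
  have h3 : ‖z‖ < 1 := by simpa using hz
  rw [mem_ball_zero_iff, norm_smul, Real.norm_eq_abs, abs_of_nonneg hr]
  nlinarith [norm_nonneg z]

lemma sec_dil {u : E2 → ℝ} (hu : ContDiffOn ℝ (⊤ : ℕ∞) u (ball (0 : E2) 1)) {z : E2} {r : ℝ}
    (hz : r • z ∈ ball (0 : E2) 1) (v : E2) :
    Sec (fun s => u (r • (z + s • v))) (r ^ 2 * hess u (r • z) v v) := by
  have h := sec_line hu hz (r • v)
  have e : hess u (r • z) (r • v) (r • v) = r ^ 2 * hess u (r • z) v v := by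
    simp [hess]; ring
  rw [e] at h
  convert h using 3 with s
  rw [smul_add, smul_comm]

lemma det_interior {u u₁ : E2 → ℝ} (hu : ContDiffOn ℝ (⊤ : ℕ∞) u (ball (0 : E2) 1))
    (hu₁ : ContDiffOn ℝ (⊤ : ℕ∞) u₁ (ball (0 : E2) 1))
    (hu₁c : ConvexOn ℝ (ball (0 : E2) 1) u₁) {z : E2} {r : ℝ}
    (hz : z ∈ ball (0 : E2) 1) (hrz : r • z ∈ ball (0 : E2) 1) 
    (c ε : ℝ) (hc : 0 ≤ c) (hε : 0 ≤ ε)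
    (hmin : ∀ w ∈ ball (0 : E2) 1, u z - u₁ (r • z) + c * √(1 - ‖z‖ ^ 2) - ε * ‖z‖ ^ 2
      ≤ u w - u₁ (r • w) + c * √(1 - ‖w‖ ^ 2) - ε * ‖w‖ ^ 2) :
    r ^ 4 * detHess u₁ (r • z) + 4 * ε ^ 2 ≤ detHess u z := by
  obtain ⟨p, q, s, hdet, hform⟩ := hess_coord hu hz
  obtain ⟨p', q', s', hdet', hform'⟩ := hess_coord hu₁ hrz
  have hpos := sub_pos_of_ball hz
  have hQ : 0 < √(1 - ‖z‖ ^ 2) := Real.sqrt_pos.2 hpos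
  have key := fun x y : ℝ => min_hess (f := fun w => u₁ (r • w)) hu hz
    (fun v => r ^ 2 * hess u₁ (r • z) v v) (fun v => sec_dil hu₁ hrz v) c ε hmin !₂[x, y]
  obtain ⟨i1, i2, i3⟩ := psd_coef (a := p') (b := q') (c := s') (fun x y => by
    rw [← hform']; exact hess_nonneg hu₁ hu₁c hrz _)
  have hr4 : (r ^ 2 * q') ^ 2 ≤ (r ^ 2 * p') * (r ^ 2 * s') := by
    have : r ^ 4 * q' ^ 2 ≤ r ^ 4 * (p' * s') := by gcongr
    nlinarith
  have j := det_add (a := r ^ 2 * p') (b := r ^ 2 * q') (c := r ^ 2 * s') (p := 2 * ε) (q := 0)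
    (r := 2 * ε) (by positivity) (by positivity) hr4 (by positivity) (by positivity)
    (by nlinarith [sq_nonneg ε])
  have k := det_mono (a := r ^ 2 * p' + 2 * ε) (b := r ^ 2 * q' + 0) (c := r ^ 2 * s' + 2 * ε)
    (p := p) (q := q) (r := s) (by positivity) (by positivity)
    (by nlinarith [sq_nonneg ε]) (fun x y => by
      have h1 := key x y
      simp only [hform, hform'] at h1
      have e1 : ‖(!₂[x, y] : E2)‖ ^ 2 = x ^ 2 + y ^ 2 := by
        rw [EuclideanSpace.norm_sq_eq]; simp [Fin.sum_univ_two]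
      have h2 : 0 ≤ c * (‖(!₂[x, y] : E2)‖ ^ 2 / √(1 - ‖z‖ ^ 2)
        + ⟪z, (!₂[x, y] : E2)⟫ ^ 2 / √(1 - ‖z‖ ^ 2) ^ 3) := by positivity
      rw [e1] at h1 h2
      linarith)
  rw [hdet, hdet']
  linarith

/-- Failure of `u < φ z + τ` frequently means that `u` blows up at `z`. -/
lemma blowup {u : E2 → ℝ} {z : E2} {L t : ℝ}
    (hb : Filter.liminf u (𝓝[ball (0 : E2) 1] z) = L) (ht : L < t)
    (h : ∀ᶠ w in 𝓝[ball (0 : E2) 1] z, t ≤ u w) (T : ℝ) :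
    ∀ᶠ w in 𝓝[ball (0 : E2) 1] z, T ≤ u w := by
  rw [Filter.liminf_eq] at hb
  by_cases hbd : BddAbove {a : ℝ | ∀ᶠ w in 𝓝[ball (0 : E2) 1] z, a ≤ u w}
  · have := le_csSup hbd h
    linarith
  · rw [not_bddAbove_iff] at hbd
    obtain ⟨y, hy, hTy⟩ := hbd T
    have hy' : ∀ᶠ w in 𝓝[ball (0 : E2) 1] z, y ≤ u w := hy
    exact hy'.mono fun w hw => hTy.le.trans hw

lemma freq_lt {φ u ψ : E2 → ℝ} {M a : ℝ} (hφ : ∀ z ∈ sphere (0 : E2) 1, |φ z| ≤ M)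
    (ha : 0 < a) (hψ : ∀ z ∈ ball (0 : E2) 1, a ≤ ψ z)
    (hu : ContDiffOn ℝ (⊤ : ℕ∞) u (ball (0 : E2) 1))
    (hc : ConvexOn ℝ (ball (0 : E2) 1) u)
    (heq : ∀ z ∈ ball (0 : E2) 1, detHess u z = (1 / ψ z) * ((1 - ‖z‖ ^ 2) ^ 2)⁻¹)
    (hbd : ∀ z ∈ sphere (0 : E2) 1, Filter.liminf u (𝓝[ball (0 : E2) 1] z) = φ z)
    {z : E2} (hz : z ∈ sphere (0 : E2) 1) {τ : ℝ} (hτ : 0 < τ) :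
    ∃ᶠ w in 𝓝[ball (0 : E2) 1] z, u w < φ z + τ := by
  intro hcon
  have hT := blowup (hbd z hz) (by linarith : φ z < φ z + τ) (hcon.mono fun w hw => not_lt.1 hw)
  have hN := hT (M + 1)
  obtain ⟨δ, hδ, hsub⟩ := Metric.mem_nhdsWithin_iff.1 hN
  have hz1 : ‖z‖ = 1 := by simpa using hz
  -- all nearby sphere points blow up
  have hnear : ∀ p ∈ sphere (0 : E2) 1, dist p z < δ → ∀ T : ℝ,
      ∀ᶠ w in 𝓝[ball (0 : E2) 1] p, T ≤ u w := by
    intro p hp hpz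
    refine blowup (hbd p hp) (t := M + 1) ?_ ?_
    · have := le_abs_self (φ p); linarith [hφ p hp]
    · have : ball z δ ∈ 𝓝[ball (0 : E2) 1] p :=
        mem_nhdsWithin_of_mem_nhds (isOpen_ball.mem_nhds hpz)
      filter_upwards [this, self_mem_nhdsWithin] with w h1 h2 using hsub ⟨h1, h2⟩
  obtain ⟨L, hL⟩ := bdd_below hu hc
  set κ : ℝ := min (δ ^ 2 / 4) (1 / 2) with hκ
  have hκ0 : 0 < κ := lt_min (by positivity) (by norm_num)
  have hκ1 : κ ≤ δ ^ 2 / 4 := min_le_left _ _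
  have hκ2 : κ ≤ 1 / 2 := min_le_right _ _
  set c : ℝ := 1 + 1 / a with hcdef
  have hc0 : 0 < c := by positivity
  -- the main barrier estimate
  have main : ∀ n : ℝ, 0 < n → ∀ w ∈ ball (0 : E2) 1,
      L - 1 ≤ u w - n * (⟪z, w⟫ - (1 - κ)) + c * √(1 - ‖w‖ ^ 2) - 0 * ‖w‖ ^ 2 := by
    intro n hn w hw
    by_contra hlt
    push Not at hlt
    have hcu : ContinuousOn u (ball (0 : E2) 1) := hu.continuousOn
    obtain ⟨z0, hz0, -, hmin⟩ := exists_min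
      (F := fun w => u w - n * (⟪z, w⟫ - (1 - κ)) + c * √(1 - ‖w‖ ^ 2) - 0 * ‖w‖ ^ 2)
      (by fun_prop) (L - 1) (by
        intro p hp
        by_cases hpk : 1 - κ ≤ ⟪z, p⟫
        · have hp1 : ‖p‖ = 1 := by simpa using hp
          have hd : dist p z < δ := by
            rw [dist_eq_norm]
            have : ‖p - z‖ ^ 2 = 2 - 2 * ⟪z, p⟫ := by
              rw [norm_sub_sq_real, real_inner_comm, hp1, hz1]; ring
            apply lt_of_pow_lt_pow_left₀ 2 hδ.le
            nlinarith
          filter_upwards [hnear p hp hd (L + n), self_mem_nhdsWithin] with w h1 h2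
          have h3 : ⟪z, w⟫ ≤ 1 := by
            have := real_inner_le_norm z w
            have h4 : ‖w‖ < 1 := by simpa using h2
            rw [hz1] at this; linarith
          have h5 : n * (⟪z, w⟫ - (1 - κ)) ≤ n * 1 := by
            gcongr; linarith
          have h6 : 0 ≤ c * √(1 - ‖w‖ ^ 2) := by positivity
          linarith
        · push Not at hpk
          have hcont : ContinuousAt (fun w : E2 => ⟪z, w⟫) p := by fun_prop
          have h1 := (hcont.eventually (gt_mem_nhds hpk)).filter_mono
            (nhdsWithin_le_nhds (s := ball (0 : E2) 1))
          filter_upwards [h1, self_mem_nhdsWithin] with w h1 h2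
          have h5 : n * (⟪z, w⟫ - (1 - κ)) ≤ 0 :=
            mul_nonpos_of_nonneg_of_nonpos hn.le (by linarith)
          have h6 : 0 ≤ c * √(1 - ‖w‖ ^ 2) := by positivity
          linarith [hL w h2]) hw hlt.le
    have hb := det_barrier (f := fun w => n * (⟪z, w⟫ - (1 - κ))) hu hz0 (fun _ => 0)
      (fun v => by
        have := sec_poly (n * (⟪z, z0⟫ - (1 - κ))) (n * ⟪z, v⟫) 0
        simp only [mul_zero] at this
        convert this using 2 with s
        rw [inner_add_right, inner_smul_right]; ring) (fun _ => le_rfl) c 0 hc0.le le_rfl hmin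
    rw [heq z0 hz0] at hb
    have hpos := sub_pos_of_ball hz0
    have h7 : c ^ 2 ≤ 1 / ψ z0 := le_of_mul_le_mul_right hb (by positivity)
    have h8 : 1 / ψ z0 ≤ 1 / a := one_div_le_one_div_of_le ha (hψ z0 hz0)
    have h9 : 0 < 1 / a := by positivity
    nlinarith
  -- contradiction at a point of the cap
  set w : E2 := (1 - κ / 2) • z with hw
  have hwb : w ∈ ball (0 : E2) 1 := by
    rw [mem_ball_zero_iff, hw, norm_smul, hz1, Real.norm_eq_abs, abs_of_pos (by linarith)]
    linarith
  have hin : ⟪z, w⟫ = 1 - κ / 2 := by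
    rw [hw, inner_smul_right, real_inner_self_eq_norm_sq, hz1]; ring
  have hm := main ((|u w + c * √(1 - ‖w‖ ^ 2) - L + 1| + 1) * (2 / κ)) (by positivity) w hwb
  rw [hin] at hm
  have e : (|u w + c * √(1 - ‖w‖ ^ 2) - L + 1| + 1) * (2 / κ) * (1 - κ / 2 - (1 - κ))
      = |u w + c * √(1 - ‖w‖ ^ 2) - L + 1| + 1 := by
    field_simp; ring
  rw [e] at hm
  have := le_abs_self (u w + c * √(1 - ‖w‖ ^ 2) - L + 1)
  linarith

/-- **Lemma 3.8 (comparison lemma).** If `φ₁ ≤ φ₂` on `∂𝔻` and `ψ₁ ≤ ψ₂` on `𝔻`, then the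
corresponding smooth convex solutions of `det D²uᵢ(z) = (1/ψᵢ(z))·(1−|z|²)⁻²` with boundary
values `φᵢ` satisfy `u₁ ≤ u₂` on `𝔻`. -/
theorem comparison_monge_ampere
    (φ₁ φ₂ : E2 → ℝ)
    (hφ₁b : ∃ M : ℝ, ∀ z ∈ sphere (0 : E2) 1, |φ₁ z| ≤ M)
    (hφ₁l : LowerSemicontinuousOn φ₁ (sphere (0 : E2) 1))
    (hφ₂b : ∃ M : ℝ, ∀ z ∈ sphere (0 : E2) 1, |φ₂ z| ≤ M)
    (hφ₂l : LowerSemicontinuousOn φ₂ (sphere (0 : E2) 1))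
    (ψ₁ ψ₂ : E2 → ℝ) (a b : ℝ) (ha : 0 < a) (hab : a ≤ b)
    (hψ₁s : ContDiffOn ℝ (⊤ : ℕ∞) ψ₁ (ball (0 : E2) 1))
    (hψ₂s : ContDiffOn ℝ (⊤ : ℕ∞) ψ₂ (ball (0 : E2) 1))
    (hψ₁ : ∀ z ∈ ball (0 : E2) 1, a ≤ ψ₁ z ∧ ψ₁ z ≤ b)
    (hψ₂ : ∀ z ∈ ball (0 : E2) 1, a ≤ ψ₂ z ∧ ψ₂ z ≤ b)
    (hφ : ∀ z ∈ sphere (0 : E2) 1, φ₁ z ≤ φ₂ z)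
    (hψ : ∀ z ∈ ball (0 : E2) 1, ψ₁ z ≤ ψ₂ z)
    (u₁ u₂ : E2 → ℝ)
    (hu₁s : ContDiffOn ℝ (⊤ : ℕ∞) u₁ (ball (0 : E2) 1))
    (hu₁c : ConvexOn ℝ (ball (0 : E2) 1) u₁)
    (hu₁eq : ∀ z ∈ ball (0 : E2) 1,
      detHess u₁ z = (1 / ψ₁ z) * ((1 - ‖z‖ ^ 2) ^ 2)⁻¹)
    (hu₁bd : ∀ z ∈ sphere (0 : E2) 1,
      Filter.liminf u₁ (𝓝[ball (0 : E2) 1] z) = φ₁ z)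
    (hu₂s : ContDiffOn ℝ (⊤ : ℕ∞) u₂ (ball (0 : E2) 1))
    (hu₂c : ConvexOn ℝ (ball (0 : E2) 1) u₂)
    (hu₂eq : ∀ z ∈ ball (0 : E2) 1,
      detHess u₂ z = (1 / ψ₂ z) * ((1 - ‖z‖ ^ 2) ^ 2)⁻¹)
    (hu₂bd : ∀ z ∈ sphere (0 : E2) 1,
      Filter.liminf u₂ (𝓝[ball (0 : E2) 1] z) = φ₂ z) :
    ∀ z ∈ ball (0 : E2) 1, u₁ z ≤ u₂ z := by
  intro z' hz'
  by_contra hlt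
  push Not at hlt
  obtain ⟨M, hM⟩ := hφ₁b
  set d : ℝ := u₁ z' - u₂ z' with hd
  have hd0 : 0 < d := by linarith
  set C : ℝ := Real.exp 1 * (1 + 1 / a) with hC
  have hC0 : 0 < C := by positivity
  set K : ℝ := 10 * C / d + 1 with hK
  have hK0 : 0 < K := by positivity
  have hCK : C / K ≤ d / 10 := by
    rw [div_le_iff₀ hK0, hK]
    have : d / 10 * (10 * C / d + 1) = C + d / 10 := by field_simp
    linarith
  have hCK0 : 0 < C / K := by positivity
  set ε : ℝ := d / 10 with hε
  have hε0 : 0 < ε := by positivity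
  set Ks : Set E2 := {z | ‖z‖ ^ 2 ≤ 1 - (1 / K) ^ 2} with hKs
  have hKsb : Ks ⊆ ball (0 : E2) 1 := by
    intro z hz
    have h1 : ‖z‖ ^ 2 ≤ 1 - (1 / K) ^ 2 := hz
    have h2 : 0 < (1 / K) ^ 2 := by positivity
    rw [mem_ball_zero_iff]
    nlinarith [norm_nonneg z]
  have hKc : IsCompact Ks := by
    refine (isCompact_closedBall (0 : E2) 1).of_isClosed_subset ?_
      (hKsb.trans ball_subset_closedBall)
    exact isClosed_le (by fun_prop) (by fun_prop)
  have hev1 : ∀ᶠ r in 𝓝 (1 : ℝ), ∀ y ∈ Ks,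
      (1 / ψ₂ y) * ((1 - ‖y‖ ^ 2) ^ 2)⁻¹ <
        r ^ 4 * ((1 / ψ₁ (r • y)) * ((1 - ‖r • y‖ ^ 2) ^ 2)⁻¹) + 4 * ε ^ 2 := by
    apply hKc.eventually_forall_of_forall_eventually
    intro y hy
    have hyb := hKsb hy
    have hpos := sub_pos_of_ball hyb
    have hp1 : 0 < ψ₁ y := ha.trans_le (hψ₁ y hyb).1
    have hp2 : 0 < ψ₂ y := ha.trans_le (hψ₂ y hyb).1
    have c1 : ContinuousAt ψ₁ ((1 : ℝ) • y) := by
      rw [one_smul]; exact hψ₁s.continuousOn.continuousAt (isOpen_ball.mem_nhds hyb)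
    have c2 : ContinuousAt ψ₂ y := hψ₂s.continuousOn.continuousAt (isOpen_ball.mem_nhds hyb)
    have c3 : ContinuousAt (fun q : ℝ × E2 => q.1 • q.2) (1, y) := by fun_prop
    have c4 : ContinuousAt (fun q : ℝ × E2 => ψ₁ (q.1 • q.2)) (1, y) :=
      ContinuousAt.comp (f := fun q : ℝ × E2 => q.1 • q.2) (x := ((1 : ℝ), y)) c1 c3
    have c5 : ContinuousAt (fun q : ℝ × E2 => ψ₂ q.2) (1, y) :=
      ContinuousAt.comp (f := fun q : ℝ × E2 => q.2) (x := ((1 : ℝ), y)) c2 continuousAt_snd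
    have c6 : ContinuousAt (fun q : ℝ × E2 => ((1 - ‖q.2‖ ^ 2) ^ 2)⁻¹) (1, y) :=
      ContinuousAt.inv₀ (by fun_prop) (by positivity)
    have c7 : ContinuousAt (fun q : ℝ × E2 => ((1 - ‖q.1 • q.2‖ ^ 2) ^ 2)⁻¹) (1, y) :=
      ContinuousAt.inv₀ (by fun_prop) (by simp only [one_smul]; positivity)
    have c8 : ContinuousAt (fun q : ℝ × E2 => 1 / ψ₂ q.2) (1, y) :=
      continuousAt_const.div c5 hp2.ne'
    have c9 : ContinuousAt (fun q : ℝ × E2 => 1 / ψ₁ (q.1 • q.2)) (1, y) :=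
      continuousAt_const.div c4 (by simpa using hp1.ne')
    have cL := c8.mul c6
    have c10 : ContinuousAt (fun q : ℝ × E2 => q.1 ^ 4) (1, y) := by fun_prop
    have cR := (c10.mul (c9.mul c7)).add (continuousAt_const (y := 4 * ε ^ 2))
    refine cL.eventually_lt cR ?_
    simp only [Pi.mul_apply, one_smul, one_pow, one_mul]
    have h1 : 1 / ψ₂ y ≤ 1 / ψ₁ y := one_div_le_one_div_of_le hp1 (hψ y hyb)
    have h2 : (1 / ψ₂ y) * ((1 - ‖y‖ ^ 2) ^ 2)⁻¹ ≤ (1 / ψ₁ y) * ((1 - ‖y‖ ^ 2) ^ 2)⁻¹ := by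
      gcongr
    have h3 : 0 < 4 * ε ^ 2 := by positivity
    linarith
  have hev2 : ∀ᶠ r in 𝓝 (1 : ℝ), (1 - r) * (M + |u₁ 0|) < d / 10 := by
    have hc : ContinuousAt (fun r : ℝ => (1 - r) * (M + |u₁ 0|)) 1 := by fun_prop
    exact hc.eventually (gt_mem_nhds (by simp; exact hd0))
  have hcu1 : ∀ y ∈ ball (0 : E2) 1, ContinuousAt u₁ y := fun y hy =>
    hu₁s.continuousOn.continuousAt (isOpen_ball.mem_nhds hy)
  have hev3 : ∀ᶠ r in 𝓝 (1 : ℝ), u₁ z' - d / 10 < u₁ (r • z') := by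
    have c1 : ContinuousAt u₁ ((1 : ℝ) • z') := by rw [one_smul]; exact hcu1 z' hz'
    have c2 : ContinuousAt (fun r : ℝ => r • z') 1 := by fun_prop
    have c3 : ContinuousAt (fun r : ℝ => u₁ (r • z')) 1 :=
      ContinuousAt.comp (f := fun r : ℝ => r • z') (x := (1 : ℝ)) c1 c2
    exact c3.eventually (lt_mem_nhds (by simp; exact hd0))
  have hev4 : ∀ᶠ r in 𝓝 (1 : ℝ), (1 / 2 : ℝ) < r := lt_mem_nhds (by norm_num)
  obtain ⟨r, ⟨⟨⟨hr1, hr2⟩, hr3⟩, hr4⟩, hr5⟩ :=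
    (((((hev1.and hev2).and hev3).and hev4).filter_mono
      (nhdsWithin_le_nhds (s := Set.Iio 1))).and self_mem_nhdsWithin).exists
  have hr5 : r < 1 := hr5
  have hr0 : 0 < r := by linarith
  obtain ⟨L₂, hL₂⟩ := bdd_below hu₂s hu₂c
  -- the dilated function at the boundary
  have hrz : ∀ z ∈ sphere (0 : E2) 1, r • z ∈ ball (0 : E2) 1 := by
    intro z hz
    have hz1 : ‖z‖ = 1 := by simpa using hz
    rw [mem_ball_zero_iff, norm_smul, hz1, Real.norm_eq_abs, abs_of_pos hr0]
    linarith
  have hcd : ∀ z, r • z ∈ ball (0 : E2) 1 → ContinuousAt (fun w => u₁ (r • w)) z := by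
    intro z hz
    exact ContinuousAt.comp (f := fun w : E2 => r • w) (x := z) (hcu1 _ hz) (by fun_prop)
  have hdil : ∀ z ∈ sphere (0 : E2) 1, u₁ (r • z) ≤ φ₁ z + 3 * (d / 10) := by
    intro z hz
    have hf := freq_lt hM ha (fun z hz => (hψ₁ z hz).1) hu₁s hu₁c hu₁eq hu₁bd hz
      (τ := d / 10) (by positivity)
    have h1 := ((hcd z (hrz z hz)).eventually
      (lt_mem_nhds (by linarith : u₁ (r • z) - d / 10 < u₁ (r • z)))).filter_mono
      (nhdsWithin_le_nhds (s := ball (0 : E2) 1))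
    obtain ⟨w, hw1, hw2, hw3⟩ := (hf.and_eventually (h1.and self_mem_nhdsWithin)).exists
    have h2 := hu₁c.2 hw3 (by simp : (0 : E2) ∈ ball (0 : E2) 1) hr0.le
      (by linarith : 0 ≤ 1 - r) (by ring)
    simp only [smul_zero, add_zero, smul_eq_mul] at h2
    have h3 : r * u₁ w ≤ r * (φ₁ z + d / 10) := by gcongr
    have h4 := (abs_le.1 (hM z hz)).1
    have h5 : (1 - r) * u₁ 0 ≤ (1 - r) * |u₁ 0| := by
      gcongr
      exact le_abs_self _
    have h6 : 0 ≤ (1 - r) * (M + φ₁ z) := mul_nonneg (by linarith) (by linarith)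
    have h7 : r * (d / 10) ≤ d / 10 := by nlinarith
    nlinarith
  have hg : ∀ w : E2, 0 < C / K * Real.exp (-(K * √(1 - ‖w‖ ^ 2))) ∧
      C / K * Real.exp (-(K * √(1 - ‖w‖ ^ 2))) ≤ C / K := by
    intro w
    refine ⟨by positivity, mul_le_of_le_one_right hCK0.le ?_⟩
    rw [Real.exp_le_one_iff]
    have : 0 ≤ K * √(1 - ‖w‖ ^ 2) := by positivity
    linarith
  have hcu2 : ContinuousOn u₂ (ball (0 : E2) 1) := hu₂s.continuousOn
  have hcu1r : ContinuousOn (fun w => u₁ (r • w)) (ball (0 : E2) 1) := fun z hz =>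
    (hcd z (smul_mem hz hr0.le hr5.le)).continuousWithinAt
  have hcg : Continuous fun w : E2 => C / K * Real.exp (-(K * √(1 - ‖w‖ ^ 2))) := by fun_prop
  have hcn : Continuous fun w : E2 => ε * ‖w‖ ^ 2 := by fun_prop
  obtain ⟨z0, hz0, -, hmin⟩ := exists_min
    (F := fun w => u₂ w - u₁ (r • w) - C / K * Real.exp (-(K * √(1 - ‖w‖ ^ 2))) - ε * ‖w‖ ^ 2)
    (((hcu2.sub hcu1r).sub hcg.continuousOn).sub hcn.continuousOn) (-(8 * (d / 10))) (by
      intro z hz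
      have hbdd : IsBoundedUnder (· ≥ ·) (𝓝[ball (0 : E2) 1] z) u₂ :=
        isBoundedUnder_of_eventually_ge (a := L₂)
          (eventually_mem_nhdsWithin.mono fun w hw => hL₂ w hw)
      have h1 := eventually_lt_of_lt_liminf
        (by rw [hu₂bd z hz]; linarith : φ₂ z - d / 10 < Filter.liminf u₂ (𝓝[ball (0 : E2) 1] z))
        hbdd
      have h2 := ((hcd z (hrz z hz)).eventually
        (gt_mem_nhds (by linarith : u₁ (r • z) < u₁ (r • z) + d / 10))).filter_mono
        (nhdsWithin_le_nhds (s := ball (0 : E2) 1))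
      filter_upwards [h1, h2, self_mem_nhdsWithin] with w k1 k2 k3
      have k4 : ‖w‖ < 1 := by simpa using k3
      have k5 : ε * ‖w‖ ^ 2 ≤ ε := by
        apply mul_le_of_le_one_right hε0.le
        nlinarith [norm_nonneg w]
      have k6 := (hg w).2
      have k7 := hdil z hz
      have k8 := hφ z hz
      linarith) hz' (by
      have k6 := (hg z').1
      have k7 : 0 ≤ ε * ‖z'‖ ^ 2 := by positivity
      linarith)
  -- replace the exponential barrier by its tangent
  set c : ℝ := C * Real.exp (-(K * √(1 - ‖z0‖ ^ 2))) with hc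
  have hc0 : 0 < c := by positivity
  have hmin2 : ∀ w ∈ ball (0 : E2) 1,
      u₂ z0 - u₁ (r • z0) + c * √(1 - ‖z0‖ ^ 2) - ε * ‖z0‖ ^ 2
      ≤ u₂ w - u₁ (r • w) + c * √(1 - ‖w‖ ^ 2) - ε * ‖w‖ ^ 2 := by
    intro w hw
    have h1 := hmin w hw
    set q := √(1 - ‖w‖ ^ 2)
    set q0 := √(1 - ‖z0‖ ^ 2)
    have h2 : Real.exp (-(K * q)) = Real.exp (-(K * q0)) * Real.exp (K * (q0 - q)) := by
      rw [← Real.exp_add]; congr 1; ring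
    have h3 := Real.add_one_le_exp (K * (q0 - q))
    have h4 : C / K * Real.exp (-(K * q0)) * (K * (q0 - q) + 1)
        ≤ C / K * Real.exp (-(K * q0)) * Real.exp (K * (q0 - q)) := by gcongr
    have h5 : C / K * Real.exp (-(K * q0)) * (K * (q0 - q) + 1)
        = c * (q0 - q) + C / K * Real.exp (-(K * q0)) := by
      rw [hc]; field_simp
    rw [h2] at h1
    linarith
  have hpos := sub_pos_of_ball hz0
  have hrz0 : r • z0 ∈ ball (0 : E2) 1 := smul_mem hz0 hr0.le hr5.le
  by_cases hcase : √(1 - ‖z0‖ ^ 2) ≤ 1 / K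
  · have hb := det_barrier (f := fun w => u₁ (r • w)) hu₂s hz0
      (fun v => r ^ 2 * hess u₁ (r • z0) v v) (fun v => sec_dil hu₁s hrz0 v)
      (fun v => mul_nonneg (sq_nonneg r) (hess_nonneg hu₁s hu₁c hrz0 v)) c ε hc0.le hε0.le hmin2
    rw [hu₂eq z0 hz0] at hb
    have h7 : c ^ 2 ≤ 1 / ψ₂ z0 := le_of_mul_le_mul_right hb (by positivity)
    have h8 : 1 / ψ₂ z0 ≤ 1 / a := one_div_le_one_div_of_le ha (hψ₂ z0 hz0).1
    have h9 : 0 < 1 / a := by positivity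
    have h10 : 1 + 1 / a ≤ c := by
      have h11 : K * √(1 - ‖z0‖ ^ 2) ≤ 1 := by
        rw [le_div_iff₀ hK0] at hcase; linarith
      have h12 : 1 ≤ Real.exp 1 * Real.exp (-(K * √(1 - ‖z0‖ ^ 2))) := by
        rw [← Real.exp_add]; apply Real.one_le_exp; linarith
      calc 1 + 1 / a = 1 * (1 + 1 / a) := by ring
        _ ≤ (Real.exp 1 * Real.exp (-(K * √(1 - ‖z0‖ ^ 2)))) * (1 + 1 / a) := by gcongr
        _ = c := by rw [hc, hC]; ring
    nlinarith
  · push Not at hcase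
    have hmem : z0 ∈ Ks := by
      have h1 : (1 / K) ^ 2 ≤ √(1 - ‖z0‖ ^ 2) ^ 2 := by gcongr
      rw [Real.sq_sqrt hpos.le] at h1
      show ‖z0‖ ^ 2 ≤ 1 - (1 / K) ^ 2
      linarith
    have hb := det_interior hu₂s hu₁s hu₁c hz0 hrz0 c ε hc0.le hε0.le hmin2
    rw [hu₂eq z0 hz0, hu₁eq _ hrz0] at hb
    linarith [hr1 z0 hmem]
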